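/- arXiv:1002.1347 — 2 statements merged into one kernel-verified Lean document; each statement's English description precedes it below -/
import Mathlib

section
/- Converse (privacy) part of the rate-distortion-equivocation theorem with side information at the user: every (n, M) code whose average distortion satisfies Δ ≤ D has equivocation Δ_p ≤ Γ(D). -/
open scoped BigOperators
open Classical

noncomputable section

/-- A probability mass function on a finite type: a nonnegative function summing to 1. -/
def IsPMF {α : Type} [Fintype α] (q : α → ℝ) : Prop :=
  (∀ a, 0 ≤ q a) ∧ ∑ a, q a = 1

/-- A conditional pmf (channel) from `α` to `β`. -/
def IsKernel {α β : Type} [Fintype β] (k : α → β → ℝ) : Prop :=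
  ∀ a, (∀ b, 0 ≤ k a b) ∧ ∑ b, k a b = 1

/-- Pushforward distribution of a pmf `μ` along a map `f`. -/
def pushf {Ω α : Type} [Fintype Ω] (μ : Ω → ℝ) (f : Ω → α) : α → ℝ :=
  fun a => ∑ ω, if f ω = a then μ ω else 0

/-- Shannon entropy (base 2) of a pmf; the convention `0 · log 0 = 0` is automatic
since `Real.logb 2 0 = 0` in Mathlib. -/
def ent {α : Type} [Fintype α] (q : α → ℝ) : ℝ :=
  -∑ a, q a * Real.logb 2 (q a)

/-- Entropy of the random variable `f` under the pmf `μ`. -/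
def Hof {Ω α : Type} [Fintype Ω] [Fintype α] (μ : Ω → ℝ) (f : Ω → α) : ℝ :=
  ent (pushf μ f)

/-- Conditional Shannon entropy `H(f | g)` under `μ`. -/
def condH {Ω α β : Type} [Fintype Ω] [Fintype α] [Fintype β]
    (μ : Ω → ℝ) (f : Ω → α) (g : Ω → β) : ℝ :=
  Hof μ (fun ω => (f ω, g ω)) - Hof μ g

/-- Shannon mutual information `I(f ; g)` under `μ`. -/
def mutI {Ω α β : Type} [Fintype Ω] [Fintype α] [Fintype β]
    (μ : Ω → ℝ) (f : Ω → α) (g : Ω → β) : ℝ :=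
  Hof μ f + Hof μ g - Hof μ (fun ω => (f ω, g ω))

/-- Expectation of `h` under the pmf `μ`. -/
def expect {Ω : Type} [Fintype Ω] (μ : Ω → ℝ) (h : Ω → ℝ) : ℝ :=
  ∑ ω, μ ω * h ω

/-- The i.i.d. product pmf of `n` copies of `p`. -/
def iidPMF {α : Type} [Fintype α] (p : α → ℝ) (n : ℕ) : (Fin n → α) → ℝ :=
  fun x => ∏ i, p (x i)


/-- Joint pmf of `((X_r, X_h, Z), U)` obtained from the source pmf `p` and a conditional
pmf `pu = p(u | x_r, x_h)`; the Markov chain `U — (X_r, X_h) — Z` is built in. -/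
def jointU {Xr Xh Z U : Type} (p : Xr × Xh × Z → ℝ) (pu : Xr × Xh → U → ℝ) :
    (Xr × Xh × Z) × U → ℝ :=
  fun su => p su.1 * pu (su.1.1, su.1.2.1) su.2

/-- The set of equivocations `H(X_h | U, Z)` over all finite `U`, conditional pmfs
`p(u | x_r, x_h)` and functions `g : U × Z → X̂` with `E[d(X_r, g(U, Z))] ≤ D`. -/
def GammaSet {Xr Xh Z Xhat : Type} [Fintype Xr] [Fintype Xh] [Fintype Z] [Fintype Xhat]
    (p : Xr × Xh × Z → ℝ) (d : Xr → Xhat → ℝ) (D : ℝ) : Set ℝ :=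
  { e | ∃ (U : Type) (_ : Fintype U) (pu : Xr × Xh → U → ℝ) (g : U × Z → Xhat),
      IsKernel pu ∧
      expect (jointU p pu) (fun su => d su.1.1 (g (su.2, su.1.2.2))) ≤ D ∧
      e = condH (jointU p pu) (fun su => su.1.2.1) (fun su => (su.2, su.1.2.2)) }

/-- `Γ(D)`, the maximal achievable equivocation at distortion `D`. -/
def Gamma {Xr Xh Z Xhat : Type} [Fintype Xr] [Fintype Xh] [Fintype Z] [Fintype Xhat]
    (p : Xr × Xh × Z → ℝ) (d : Xr → Xhat → ℝ) (D : ℝ) : ℝ :=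
  sSup (GammaSet p d D)

/-- The reconstruction `X̂ⁿ` produced by an `(n, M)` code from the source realization. -/
def recon {Xr Xh Z Xhat : Type} {n M : ℕ}
    (FE : (Fin n → Xr × Xh) → Fin M) (FD : Fin M × (Fin n → Z) → Fin n → Xhat)
    (x : Fin n → Xr × Xh × Z) : Fin n → Xhat :=
  FD (FE (fun i => ((x i).1, (x i).2.1)), fun i => (x i).2.2)

/-- Average per-letter distortion `Δ` of an `(n, M)` code. -/
def avgDist {Xr Xh Z Xhat : Type} [Fintype Xr] [Fintype Xh] [Fintype Z] [Fintype Xhat]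
    (p : Xr × Xh × Z → ℝ) (d : Xr → Xhat → ℝ) {n M : ℕ}
    (FE : (Fin n → Xr × Xh) → Fin M) (FD : Fin M × (Fin n → Z) → Fin n → Xhat) : ℝ :=
  (1 / (n : ℝ)) * expect (iidPMF p n) (fun x => ∑ i, d ((x i).1) (recon FE FD x i))

/-- Equivocation `Δ_p = (1/n) H(X_hⁿ | W, Zⁿ)` of an `(n, M)` code. -/
def equivoc {Xr Xh Z Xhat : Type} [Fintype Xr] [Fintype Xh] [Fintype Z] [Fintype Xhat]
    (p : Xr × Xh × Z → ℝ) {n M : ℕ}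
    (FE : (Fin n → Xr × Xh) → Fin M) (_FD : Fin M × (Fin n → Z) → Fin n → Xhat) : ℝ :=
  (1 / (n : ℝ)) * condH (iidPMF p n)
      (fun x => fun i => (x i).2.1)
      (fun x => (FE (fun i => ((x i).1, (x i).2.1)), fun i => (x i).2.2))

section Entropy

variable {Ω α β : Type} [Fintype Ω]

theorem sum_pushf_mul [Fintype α] (μ : Ω → ℝ) (f : Ω → α) (h : α → ℝ) :
    ∑ a, pushf μ f a * h a = ∑ ω, μ ω * h (f ω) := by
  simp only [pushf, Finset.sum_mul]
  rw [Finset.sum_comm]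
  refine Finset.sum_congr rfl fun ω _ => ?_
  simp [ite_mul]

theorem sum_pushf [Fintype α] (μ : Ω → ℝ) (f : Ω → α) : ∑ a, pushf μ f a = ∑ ω, μ ω := by
  simpa using sum_pushf_mul μ f (fun _ => 1)

theorem pushf_nonneg {μ : Ω → ℝ} (hμ : ∀ ω, 0 ≤ μ ω) (f : Ω → α) (a : α) :
    0 ≤ pushf μ f a :=
  Finset.sum_nonneg fun ω _ => by split_ifs <;> simp [hμ ω]

theorem le_pushf_apply {μ : Ω → ℝ} (hμ : ∀ ω, 0 ≤ μ ω) (f : Ω → α) (ω : Ω) :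
    μ ω ≤ pushf μ f (f ω) := by
  have h := Finset.single_le_sum (f := fun ω' => if f ω' = f ω then μ ω' else 0)
    (fun ω' _ => by split_ifs <;> simp [hμ ω']) (Finset.mem_univ ω)
  simpa [pushf] using h

/-- Marginalizing the first component of a joint distribution. -/
theorem sum_pushf_prodMk [Fintype α] (μ : Ω → ℝ) (f : Ω → α) (g : Ω → β) (b : β) :
    ∑ a, pushf μ (fun ω => (f ω, g ω)) (a, b) = pushf μ g b := by
  simp only [pushf]
  rw [Finset.sum_comm]
  refine Finset.sum_congr rfl fun ω _ => ?_
  by_cases h : g ω = b <;> simp [h]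

theorem Hof_eq_expect [Fintype α] (μ : Ω → ℝ) (f : Ω → α) :
    Hof μ f = expect μ (fun ω => -Real.logb 2 (pushf μ f (f ω))) := by
  simp only [Hof, ent, expect, mul_neg, Finset.sum_neg_distrib]
  rw [sum_pushf_mul μ f (fun a => Real.logb 2 (pushf μ f a))]

theorem condH_eq_expect [Fintype α] [Fintype β] (μ : Ω → ℝ) (f : Ω → α) (g : Ω → β) :
    condH μ f g = expect μ (fun ω => Real.logb 2 (pushf μ g (g ω)) -
      Real.logb 2 (pushf μ (fun ω => (f ω, g ω)) (f ω, g ω))) := by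
  rw [condH, Hof_eq_expect, Hof_eq_expect]
  simp only [expect, ← Finset.sum_sub_distrib]
  exact Finset.sum_congr rfl fun ω _ => by ring

/-- Gibbs' inequality: the conditional entropy is at most the cross entropy with respect to any
subprobability kernel that is positive on the support. -/
theorem condH_le_expect_neg_logb [Fintype α] [Fintype β] {μ : Ω → ℝ} (hμ : ∀ ω, 0 ≤ μ ω)
    (f : Ω → α) (g : Ω → β) (q : α → β → ℝ) (hq : ∀ a b, 0 ≤ q a b) (hq1 : ∀ b, ∑ a, q a b ≤ 1)
    (hpos : ∀ ω, 0 < μ ω → 0 < q (f ω) (g ω)) :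
    condH μ f g ≤ expect μ (fun ω => -Real.logb 2 (q (f ω) (g ω))) := by
  rw [condH_eq_expect, ← sub_nonpos]
  simp only [expect, ← Finset.sum_sub_distrib]
  set P := pushf μ (fun ω => (f ω, g ω)) with hP
  set G := pushf μ g with hG
  have hlog2 : 0 < Real.log 2 := Real.log_pos (by norm_num)
  have hG0 : ∀ b, 0 ≤ G b := pushf_nonneg hμ g
  have hP0 : ∀ c, 0 ≤ P c := pushf_nonneg hμ _
  have hterm : ∀ ω, μ ω * (Real.logb 2 (G (g ω)) - Real.logb 2 (P (f ω, g ω))) -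
      μ ω * -Real.logb 2 (q (f ω) (g ω)) ≤
      (μ ω * (G (g ω) * q (f ω) (g ω) / P (f ω, g ω)) - μ ω) / Real.log 2 := by
    intro ω
    rcases (hμ ω).eq_or_lt with h0 | h0
    · simp [← h0]
    · have hg : 0 < G (g ω) := h0.trans_le (le_pushf_apply hμ g ω)
      have hfg : 0 < P (f ω, g ω) :=
        h0.trans_le (le_pushf_apply hμ (fun ω => (f ω, g ω)) ω)
      have hqω := hpos ω h0
      have hl := Real.log_le_sub_one_of_pos (div_pos (mul_pos hg hqω) hfg)
      rw [Real.log_div (by positivity) hfg.ne', Real.log_mul hg.ne' hqω.ne'] at hl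
      rw [le_div_iff₀ hlog2]
      simp only [Real.logb]
      calc _ = μ ω * (Real.log (G (g ω)) + Real.log (q (f ω) (g ω)) -
            Real.log (P (f ω, g ω))) := by field_simp; ring
        _ ≤ μ ω * (G (g ω) * q (f ω) (g ω) / P (f ω, g ω) - 1) := by gcongr
        _ = _ := by ring
  refine (Finset.sum_le_sum fun ω _ => hterm ω).trans ?_
  rw [← Finset.sum_div, Finset.sum_sub_distrib]
  refine div_nonpos_of_nonpos_of_nonneg (sub_nonpos.2 ?_) hlog2.le
  rw [← sum_pushf_mul μ (fun ω => (f ω, g ω)) (fun c => G c.2 * q c.1 c.2 / P c), ← hP]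
  calc ∑ c, P c * (G c.2 * q c.1 c.2 / P c) ≤ ∑ c : α × β, G c.2 * q c.1 c.2 := by
        refine Finset.sum_le_sum fun c _ => ?_
        rcases (hP0 c).eq_or_lt with h0 | h0
        · simpa [← h0] using mul_nonneg (hG0 c.2) (hq c.1 c.2)
        · exact (mul_div_cancel₀ _ h0.ne').le
    _ = ∑ b, G b * ∑ a, q a b := by
        rw [Fintype.sum_prod_type_right]
        simp only [Finset.mul_sum]
    _ ≤ ∑ b, G b := Finset.sum_le_sum fun b _ => mul_le_of_le_one_right (hG0 b) (hq1 b)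
    _ = ∑ ω, μ ω := sum_pushf μ g

theorem condH_le_logb_card [Fintype α] [Fintype β] {μ : Ω → ℝ} (hμ : IsPMF μ)
    (f : Ω → α) (g : Ω → β) :
    condH μ f g ≤ Real.logb 2 (Fintype.card α) := by
  refine (condH_le_expect_neg_logb hμ.1 f g (fun _ _ => (Fintype.card α : ℝ)⁻¹)
    (fun _ _ => by positivity) (fun _ => ?_) fun ω _ => ?_).trans_eq ?_
  · simpa using mul_inv_le_one
  · have : Nonempty α := ⟨f ω⟩
    have := Fintype.card_pos (α := α)
    positivity
  · simp [expect, ← Finset.sum_mul, hμ.2]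

end Entropy

section Product

variable {α : Type} [Fintype α]

theorem IsPMF.iidPMF {p : α → ℝ} (hp : IsPMF p) (n : ℕ) : IsPMF (iidPMF p n) := by
  refine ⟨fun x => Finset.prod_nonneg fun i _ => hp.1 _, ?_⟩
  have h := Finset.prod_univ_sum (fun _ : Fin n => (Finset.univ : Finset α)) (fun _ a => p a)
  simp only [hp.2, Finset.prod_const_one, Fintype.piFinset_univ] at h
  exact h.symm

theorem mul_iidPMF_update (p : α → ℝ) {n : ℕ} (i : Fin n) (s : α) (x : Fin n → α) :
    p (x i) * iidPMF p n (Function.update x i s) = p s * iidPMF p n x := by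
  simp only [iidPMF]
  rw [← Finset.mul_prod_erase _ _ (Finset.mem_univ i),
    ← Finset.mul_prod_erase _ (fun j => p (x j)) (Finset.mem_univ i)]
  have h : ∏ j ∈ Finset.univ.erase i, p (Function.update x i s j) =
      ∏ j ∈ Finset.univ.erase i, p (x j) :=
    Finset.prod_congr rfl fun j hj => by rw [Function.update_of_ne (Finset.ne_of_mem_erase hj)]
  rw [h, Function.update_self]
  ring

/-- Resampling one coordinate does not change the i.i.d. distribution. -/
theorem sum_iidPMF_update {p : α → ℝ} (hp : IsPMF p) {n : ℕ} (i : Fin n)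
    (F : (Fin n → α) → ℝ) :
    ∑ s, p s * ∑ x, iidPMF p n x * F (Function.update x i s) = ∑ x, iidPMF p n x * F x := by
  let e : α × (Fin n → α) → α × (Fin n → α) := fun c => (c.2 i, Function.update c.2 i c.1)
  have he : Function.Involutive e := fun c => by simp [e]
  calc ∑ s, p s * ∑ x, iidPMF p n x * F (Function.update x i s)
      = ∑ c : α × (Fin n → α), p (e c).1 * (iidPMF p n (e c).2 * F (e c).2) := by
        rw [Fintype.sum_prod_type]
        refine Finset.sum_congr rfl fun s _ => ?_
        rw [Finset.mul_sum]
        refine Finset.sum_congr rfl fun x _ => ?_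
        simp only [e]
        rw [← mul_assoc, ← mul_assoc, mul_iidPMF_update]
    _ = ∑ c : α × (Fin n → α), p c.1 * (iidPMF p n c.2 * F c.2) :=
        Equiv.sum_comp he.toPerm (fun c => p c.1 * (iidPMF p n c.2 * F c.2))
    _ = _ := by
        rw [Fintype.sum_prod_type]
        simp only [← Finset.mul_sum]
        rw [← Finset.sum_mul, hp.2, one_mul]

end Product

section Converse

variable {Xr Xh Z Xhat : Type} {n M : ℕ}

/-- The auxiliary variable at time `i`: the time index, the message, and the side information
with its `i`-th letter masked by `z₀`. -/
def auxVar (FE : (Fin n → Xr × Xh) → Fin M) (z₀ : Z) (x : Fin n → Xr × Xh × Z) (i : Fin n) :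
    Fin n × Fin M × (Fin n → Z) :=
  (i, FE (fun j => ((x j).1, (x j).2.1)), Function.update (fun j => (x j).2.2) i z₀)

theorem auxVar_update_eq (FE : (Fin n → Xr × Xh) → Fin M) (z₀ : Z) (x : Fin n → Xr × Xh × Z)
    (i : Fin n) (s : Xr × Xh × Z) :
    auxVar FE z₀ (Function.update x i (s.1, s.2.1, z₀)) i =
      auxVar FE z₀ (Function.update x i s) i := by
  simp only [auxVar]
  congr 2
  · congr 1
    funext j
    rcases eq_or_ne j i with rfl | h <;> simp [*]
  · funext j
    rcases eq_or_ne j i with rfl | h <;> simp [*]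

variable [Fintype Xr] [Fintype Xh] [Fintype Z] [Fintype Xhat]

theorem IsPMF.jointU {U : Type} [Fintype U] {p : Xr × Xh × Z → ℝ} (hp : IsPMF p)
    {pu : Xr × Xh → U → ℝ} (hpu : IsKernel pu) : IsPMF (jointU p pu) := by
  refine ⟨fun su => mul_nonneg (hp.1 _) ((hpu _).1 _), ?_⟩
  rw [Fintype.sum_prod_type]
  simp only [_root_.jointU, ← Finset.mul_sum, (hpu _).2, mul_one, hp.2]

theorem bddAbove_GammaSet {p : Xr × Xh × Z → ℝ} (hp : IsPMF p) (d : Xr → Xhat → ℝ) (D : ℝ) :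
    BddAbove (GammaSet p d D) := by
  refine ⟨Real.logb 2 (Fintype.card Xh), ?_⟩
  rintro e ⟨U, _, pu, g, hpu, -, rfl⟩
  exact condH_le_logb_card (hp.jointU hpu) _ _

/-- The time-sharing auxiliary channel: draw a uniform time `i` and an i.i.d. source block,
replace the `i`-th source letter by the input, and output the auxiliary variable. -/
def auxKernel (p : Xr × Xh × Z → ℝ) (FE : (Fin n → Xr × Xh) → Fin M) (z₀ : Z) :
    Xr × Xh → Fin n × Fin M × (Fin n → Z) → ℝ :=
  fun a => pushf (fun c : Fin n × (Fin n → Xr × Xh × Z) => (1 / (n : ℝ)) * iidPMF p n c.2)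
    (fun c => auxVar FE z₀ (Function.update c.2 c.1 (a.1, a.2, z₀)) c.1)

theorem isKernel_auxKernel {p : Xr × Xh × Z → ℝ} (hp : IsPMF p) (hn : 0 < n)
    (FE : (Fin n → Xr × Xh) → Fin M) (z₀ : Z) : IsKernel (auxKernel p FE z₀) := by
  intro a
  refine ⟨pushf_nonneg (fun c => mul_nonneg (by positivity) ((hp.iidPMF n).1 _)) _, ?_⟩
  rw [auxKernel, sum_pushf, Fintype.sum_prod_type]
  simp only [← Finset.mul_sum, (hp.iidPMF n).2]
  have : (n : ℝ) ≠ 0 := by positivity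
  simp [this]

/-- Single-letterization: an expectation under the time-shared joint distribution is the
average over time of the expectations under the source block. -/
theorem expect_jointU_auxKernel {p : Xr × Xh × Z → ℝ} (hp : IsPMF p)
    (FE : (Fin n → Xr × Xh) → Fin M) (z₀ : Z)
    (φ : (Xr × Xh × Z) × (Fin n × Fin M × (Fin n → Z)) → ℝ) :
    expect (jointU p (auxKernel p FE z₀)) φ =
      (1 / (n : ℝ)) * expect (iidPMF p n) (fun x => ∑ i, φ (x i, auxVar FE z₀ x i)) := by
  have hs : ∀ s : Xr × Xh × Z,
      ∑ u, jointU p (auxKernel p FE z₀) (s, u) * φ (s, u) =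
        ∑ i, (1 / (n : ℝ)) * (p s * ∑ x, iidPMF p n x *
          φ (Function.update x i s i, auxVar FE z₀ (Function.update x i s) i)) := by
    intro s
    simp only [jointU, mul_assoc, ← Finset.mul_sum]
    rw [auxKernel, sum_pushf_mul _ _ (fun u => φ (s, u)), Fintype.sum_prod_type,
      Finset.mul_sum, Finset.mul_sum, Finset.mul_sum]
    refine Finset.sum_congr rfl fun i _ => ?_
    simp only [auxVar_update_eq, Function.update_self, mul_assoc, ← Finset.mul_sum]
    ring
  rw [expect, Fintype.sum_prod_type]
  simp only [hs]
  rw [Finset.sum_comm]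
  calc _ = ∑ i, (1 / (n : ℝ)) * ∑ x, iidPMF p n x * φ (x i, auxVar FE z₀ x i) :=
        Finset.sum_congr rfl fun i _ => by
          rw [← Finset.mul_sum,
            sum_iidPMF_update hp i (fun x => φ (x i, auxVar FE z₀ x i))]
    _ = _ := by
        rw [← Finset.mul_sum, Finset.sum_comm]
        simp only [expect, Finset.mul_sum]

theorem jointU_auxKernel_pos {p : Xr × Xh × Z → ℝ} (hp : IsPMF p) (hn : 0 < n)
    (FE : (Fin n → Xr × Xh) → Fin M) (z₀ : Z) {x : Fin n → Xr × Xh × Z}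
    (hx : 0 < iidPMF p n x) (i : Fin n) :
    0 < jointU p (auxKernel p FE z₀) (x i, auxVar FE z₀ x i) := by
  refine mul_pos ?_ ?_
  · refine (hp.1 _).lt_of_ne' fun h => hx.ne' ?_
    exact Finset.prod_eq_zero (Finset.mem_univ i) h
  · have h := le_pushf_apply
      (μ := fun c : Fin n × (Fin n → Xr × Xh × Z) => (1 / (n : ℝ)) * iidPMF p n c.2)
      (fun c => mul_nonneg (by positivity) ((hp.iidPMF n).1 _))
      (fun c => auxVar FE z₀ (Function.update c.2 c.1 ((x i).1, (x i).2.1, z₀)) c.1) (i, x)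
    dsimp only at h
    rw [auxVar_update_eq FE z₀ x i (x i), Function.update_eq_self] at h
    exact lt_of_lt_of_le (b := 1 / (n : ℝ) * iidPMF p n x) (by positivity) h

end Converse

/-- Converse (privacy) part: every `(n, M)` code whose average distortion
satisfies `Δ ≤ D` has equivocation `Δ_p ≤ Γ(D)`. -/
theorem equivocation_le_Gamma
    {Xr Xh Z Xhat : Type} [Fintype Xr] [Fintype Xh] [Fintype Z] [Fintype Xhat]
    (p : Xr × Xh × Z → ℝ) (hp : IsPMF p)
    (d : Xr → Xhat → ℝ) (hd : ∀ a b, 0 ≤ d a b)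
    (D : ℝ) (hD : 0 ≤ D) (n M : ℕ) (hn : 0 < n) (hM : 0 < M)
    (FE : (Fin n → Xr × Xh) → Fin M) (FD : Fin M × (Fin n → Z) → Fin n → Xhat)
    (hΔ : avgDist p d FE FD ≤ D) :
    equivoc p FE FD ≤ Gamma p d D := by
  obtain ⟨s₀⟩ : Nonempty (Xr × Xh × Z) := by
    by_contra h
    rw [not_nonempty_iff] at h
    simpa using hp.2
  let z₀ := s₀.2.2
  have hpu := isKernel_auxKernel hp hn FE z₀
  set V := jointU p (auxKernel p FE z₀) with hV
  have hV0 : ∀ su, 0 ≤ V su := (hp.jointU hpu).1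
  let G := pushf V (fun su => (su.2, su.1.2.2))
  let J := pushf V (fun su => (su.1.2.1, (su.2, su.1.2.2)))
  have hG0 : ∀ b, 0 ≤ G b := pushf_nonneg hV0 _
  have hJ0 : ∀ c, 0 ≤ J c := pushf_nonneg hV0 _
  have hmem : condH V (fun su => su.1.2.1) (fun su => (su.2, su.1.2.2)) ∈ GammaSet p d D := by
    refine ⟨_, inferInstance, auxKernel p FE z₀,
      fun uz => FD (uz.1.2.1, Function.update uz.1.2.2 uz.1.1 uz.2) uz.1.1, hpu, ?_, rfl⟩
    refine le_of_eq_of_le ?_ hΔ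
    rw [expect_jointU_auxKernel hp, avgDist]
    simp [auxVar, recon]
  refine le_trans ?_ (le_csSup (bddAbove_GammaSet hp d D) hmem)
  rw [condH_eq_expect, hV, expect_jointU_auxKernel hp, equivoc]
  refine mul_le_mul_of_nonneg_left ?_ (by positivity)
  -- the product of the single-letter conditional distributions of the hidden letters
  let q : (Fin n → Xh) → Fin M × (Fin n → Z) → ℝ := fun a b =>
    ∏ i, J (a i, ((i, b.1, Function.update b.2 i z₀), b.2 i)) /
      G ((i, b.1, Function.update b.2 i z₀), b.2 i)
  have hJpos : ∀ x, 0 < iidPMF p n x → ∀ i,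
      0 < J ((x i).2.1, (auxVar FE z₀ x i, (x i).2.2)) := fun x hx i =>
    (jointU_auxKernel_pos hp hn FE z₀ hx i).trans_le
      (le_pushf_apply hV0 (fun su => (su.1.2.1, (su.2, su.1.2.2))) (x i, auxVar FE z₀ x i))
  have hGpos : ∀ x, 0 < iidPMF p n x → ∀ i,
      0 < G (auxVar FE z₀ x i, (x i).2.2) := fun x hx i =>
    (jointU_auxKernel_pos hp hn FE z₀ hx i).trans_le
      (le_pushf_apply hV0 (fun su => (su.2, su.1.2.2)) (x i, auxVar FE z₀ x i))
  have hq : ∀ x : Fin n → Xr × Xh × Z,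
      q (fun i => (x i).2.1) (FE (fun i => ((x i).1, (x i).2.1)), fun i => (x i).2.2) =
        ∏ i, J ((x i).2.1, (auxVar FE z₀ x i, (x i).2.2)) /
          G (auxVar FE z₀ x i, (x i).2.2) := fun _ => rfl
  refine (condH_le_expect_neg_logb (hp.iidPMF n).1 _ _ q
    (fun a b => Finset.prod_nonneg fun i _ => div_nonneg (hJ0 _) (hG0 _)) (fun b => ?_)
    fun x hx => (hq x).symm ▸
      Finset.prod_pos fun i _ => div_pos (hJpos x hx i) (hGpos x hx i)).trans_eq ?_
  · have h := Finset.prod_univ_sum (fun _ : Fin n => (Finset.univ : Finset Xh))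
      (fun i a => J (a, ((i, b.1, Function.update b.2 i z₀), b.2 i)) /
        G ((i, b.1, Function.update b.2 i z₀), b.2 i))
    rw [Fintype.piFinset_univ] at h
    rw [← h]
    refine Finset.prod_le_one
      (fun i _ => Finset.sum_nonneg fun a _ => div_nonneg (hJ0 _) (hG0 _)) fun i _ => ?_
    rw [← Finset.sum_div, sum_pushf_prodMk]
    exact div_self_le_one _
  · refine Finset.sum_congr rfl fun x _ => ?_
    rcases ((hp.iidPMF n).1 x).eq_or_lt with h0 | h0
    · simp [← h0]
    · congr 1
      beta_reduce
      rw [hq x, Real.logb_prod _ _ fun i _ => (div_pos (hJpos x h0 i) (hGpos x h0 i)).ne',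
        ← Finset.sum_neg_distrib]
      refine Finset.sum_congr rfl fun i _ => ?_
      refine (congrArg Neg.neg
        (Real.logb_div (hJpos x h0 i).ne' (hGpos x h0 i).ne')).trans ?_
      exact neg_sub _ _
end
end

section
/- In the single-database problem with no side information (Z constant), the auxiliary variable in R(D, E) may be taken to be the reconstruction itself: R(D, E) = inf I(X_r, X_h; X̂), the infimum over all conditional pmfs p(x̂ | x_r, x_h) on the finite alphabet 𝒳̂ satisfying E[d(X_r, X̂)] ≤ D and H(X_h | X̂) ≥ E. -/
open scoped BigOperators
open Classical

noncomputable section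

/-- Joint pmf of `((X_r, X_h), U)` obtained from the source pmf `p` on `X_r × X_h` and a
conditional pmf `pu = p(u | x_r, x_h)` (no side information). -/
def jointU0 {Xr Xh U : Type} (p : Xr × Xh → ℝ) (pu : Xr × Xh → U → ℝ) :
    (Xr × Xh) × U → ℝ :=
  fun su => p su.1 * pu su.1 su.2

section Marginals

variable {Ω α β : Type} [Fintype Ω]

theorem pushf_apply_pos {μ : Ω → ℝ} (hμ : ∀ ω, 0 ≤ μ ω) (f : Ω → α) {ω : Ω} (hω : 0 < μ ω) :
    0 < pushf μ f (f ω) :=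
  Finset.sum_pos' (fun ω _ => by split_ifs <;> simp [hμ ω]) ⟨ω, Finset.mem_univ _, by simpa using hω⟩

theorem pushf_pushf [Fintype α] (μ : Ω → ℝ) (h : Ω → α) (f : α → β) :
    pushf (pushf μ h) f = pushf μ (fun ω => f (h ω)) := by
  funext b
  simpa [pushf] using sum_pushf_mul μ h fun a => if f a = b then 1 else 0

theorem sum_pushf_prodMk_left [Fintype α] (μ : Ω → ℝ) (f : Ω → α) (u : Ω → β) (b : β) :
    ∑ a, pushf μ (fun ω => (f ω, u ω)) (a, b) = pushf μ u b := by
  simp only [pushf]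
  rw [Finset.sum_comm]
  refine Finset.sum_congr rfl fun ω _ => ?_
  by_cases h : u ω = b <;> simp [h]

theorem expect_pushf [Fintype α] (μ : Ω → ℝ) (h : Ω → α) (k : α → ℝ) :
    expect (pushf μ h) k = expect μ (fun ω => k (h ω)) :=
  sum_pushf_mul μ h k

theorem Hof_eq_neg_sum [Fintype α] (μ : Ω → ℝ) (f : Ω → α) :
    Hof μ f = -∑ ω, μ ω * Real.logb 2 (pushf μ f (f ω)) := by
  rw [Hof, ent, sum_pushf_mul μ f fun a => Real.logb 2 (pushf μ f a)]

theorem Hof_pushf {γ : Type} [Fintype α] [Fintype γ] (μ : Ω → ℝ) (h : Ω → α) (f : α → γ) :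
    Hof (pushf μ h) f = Hof μ (fun ω => f (h ω)) := by
  rw [Hof, Hof, pushf_pushf]

end Marginals

section Conditioning

variable {Ω α β γ : Type} [Fintype Ω] [Fintype α] [Fintype β]

theorem mutI_eq_Hof_sub_condH (μ : Ω → ℝ) (f : Ω → α) (u : Ω → β) :
    mutI μ f u = Hof μ f - condH μ f u := by
  rw [mutI, condH]; ring

theorem sum_mul_likelihood_ratio_le {μ : Ω → ℝ} (hμ : ∀ ω, 0 ≤ μ ω) (f : Ω → α) (u : Ω → β)
    (g : β → γ) :
    ∑ ω, μ ω * (pushf μ u (u ω) * pushf μ (fun ω => (f ω, g (u ω))) (f ω, g (u ω)) /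
      (pushf μ (fun ω => (f ω, u ω)) (f ω, u ω) * pushf μ (fun ω => g (u ω)) (g (u ω))))
      ≤ ∑ ω, μ ω := by
  set Q := pushf μ (fun ω => (f ω, u ω))
  set R := pushf μ (fun ω => (f ω, g (u ω)))
  set S := pushf μ (fun ω => g (u ω))
  set T := pushf μ u
  have nQ : ∀ x, 0 ≤ Q x := pushf_nonneg hμ _
  have nR : ∀ x, 0 ≤ R x := pushf_nonneg hμ _
  have nS : ∀ x, 0 ≤ S x := pushf_nonneg hμ _
  have nT : ∀ x, 0 ≤ T x := pushf_nonneg hμ _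
  calc _ = ∑ x : α × β, Q x * (T x.2 * R (x.1, g x.2) / (Q x * S (g x.2))) :=
        (sum_pushf_mul μ (fun ω => (f ω, u ω))
          fun x => T x.2 * R (x.1, g x.2) / (Q x * S (g x.2))).symm
    _ ≤ ∑ x : α × β, T x.2 * (R (x.1, g x.2) / S (g x.2)) := by
        refine Finset.sum_le_sum fun x _ => ?_
        rcases (nQ x).eq_or_lt with h | h
        · rw [← h, zero_mul]
          exact mul_nonneg (nT _) (div_nonneg (nR _) (nS _))
        · rw [mul_div_assoc', mul_div_mul_left _ _ h.ne', mul_div_assoc]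
    _ = ∑ b, T b * (S (g b) / S (g b)) := by
        rw [Fintype.sum_prod_type_right]
        refine Finset.sum_congr rfl fun b _ => ?_
        dsimp only
        rw [← Finset.mul_sum, ← Finset.sum_div, sum_pushf_prodMk_left]
    _ ≤ ∑ b, T b :=
        Finset.sum_le_sum fun b _ => mul_le_of_le_one_right (nT b) (div_self_le_one _)
    _ = ∑ ω, μ ω := sum_pushf μ u

/-- Conditioning on a function of `u` leaves at least as much uncertainty as conditioning on
`u`. -/
theorem condH_le_condH_comp [Fintype γ] {μ : Ω → ℝ} (hμ : ∀ ω, 0 ≤ μ ω) (f : Ω → α) (u : Ω → β)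
    (g : β → γ) :
    condH μ f u ≤ condH μ f (fun ω => g (u ω)) := by
  have key := sum_mul_likelihood_ratio_le hμ f u g
  simp only [condH, Hof_eq_neg_sum, Real.logb, mul_div_assoc', ← Finset.sum_div]
  set Q := pushf μ (fun ω => (f ω, u ω))
  set R := pushf μ (fun ω => (f ω, g (u ω)))
  set S := pushf μ (fun ω => g (u ω))
  set T := pushf μ u
  have hlog : ∀ ω, μ ω * Real.log (T (u ω)) + μ ω * Real.log (R (f ω, g (u ω)))
      - μ ω * Real.log (Q (f ω, u ω)) - μ ω * Real.log (S (g (u ω))) ≤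
      μ ω * (T (u ω) * R (f ω, g (u ω)) / (Q (f ω, u ω) * S (g (u ω)))) - μ ω := by
    intro ω
    rcases (hμ ω).eq_or_lt with h | h
    · simp [← h]
    · have hq : 0 < Q (f ω, u ω) := pushf_apply_pos hμ (fun ω => (f ω, u ω)) h
      have hr : 0 < R (f ω, g (u ω)) := pushf_apply_pos hμ (fun ω => (f ω, g (u ω))) h
      have hs : 0 < S (g (u ω)) := pushf_apply_pos hμ (fun ω => g (u ω)) h
      have ht : 0 < T (u ω) := pushf_apply_pos hμ u h
      have hle := Real.log_le_sub_one_of_pos (div_pos (mul_pos ht hr) (mul_pos hq hs))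
      rw [Real.log_div (mul_pos ht hr).ne' (mul_pos hq hs).ne', Real.log_mul ht.ne' hr.ne',
        Real.log_mul hq.ne' hs.ne'] at hle
      linarith [mul_le_mul_of_nonneg_left hle h.le]
  have hsum := Finset.sum_le_sum fun ω (_ : ω ∈ Finset.univ) => hlog ω
  simp only [Finset.sum_sub_distrib, Finset.sum_add_distrib] at hsum
  have h2 : 0 < Real.log 2 := Real.log_pos one_lt_two
  simp only [← neg_div, ← sub_div]
  exact div_le_div_of_nonneg_right (by linarith) h2.le

/-- The data processing inequality for a deterministic map. -/
theorem mutI_comp_le [Fintype γ] {μ : Ω → ℝ} (hμ : ∀ ω, 0 ≤ μ ω) (f : Ω → α) (u : Ω → β)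
    (g : β → γ) :
    mutI μ f (fun ω => g (u ω)) ≤ mutI μ f u := by
  rw [mutI_eq_Hof_sub_condH, mutI_eq_Hof_sub_condH]
  exact sub_le_sub_left (condH_le_condH_comp hμ f u g) _

end Conditioning

theorem jointU0_nonneg {Xr Xh U : Type} [Fintype U] {p : Xr × Xh → ℝ} (hp : ∀ s, 0 ≤ p s)
    {pu : Xr × Xh → U → ℝ} (hpu : IsKernel pu) (su : (Xr × Xh) × U) : 0 ≤ jointU0 p pu su :=
  mul_nonneg (hp _) ((hpu _).1 _)

theorem isKernel_pushf {S U V : Type} [Fintype U] [Fintype V] {pu : S → U → ℝ}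
    (hpu : IsKernel pu) (g : U → V) : IsKernel fun s => pushf (pu s) g :=
  fun s => ⟨pushf_nonneg (hpu s).1 g, by rw [sum_pushf, (hpu s).2]⟩

theorem jointU0_pushf {Xr Xh U V : Type} [Fintype Xr] [Fintype Xh] [Fintype U]
    (p : Xr × Xh → ℝ) (pu : Xr × Xh → U → ℝ) (g : U → V) :
    jointU0 p (fun s => pushf (pu s) g) =
      pushf (jointU0 p pu) (fun su => (su.1, g su.2)) := by
  funext ⟨s, v⟩
  simp only [jointU0, pushf, Prod.mk.injEq]
  rw [Fintype.sum_prod_type, Finset.sum_eq_single s]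
  · simp [Finset.mul_sum]
  · intro t _ hts
    simp [hts]
  · simp

/-- In the single-database problem with no side information, the auxiliary
variable in `R(D, E)` may be taken to be the reconstruction itself:
`R(D, E) = inf I(X_r, X_h; X̂)`, the inf over conditional pmfs `p(x̂ | x_r, x_h)` with
`E[d(X_r, X̂)] ≤ D` and `H(X_h | X̂) ≥ E`. -/
theorem RDE_eq_inf_over_reconstruction
    {Xr Xh Xhat : Type} [Fintype Xr] [Fintype Xh] [Fintype Xhat]
    (p : Xr × Xh → ℝ) (hp : IsPMF p)
    (d : Xr → Xhat → ℝ) (hd : ∀ a b, 0 ≤ d a b)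
    (D E : ℝ) (hD : 0 ≤ D) (hE : 0 ≤ E) :
    sInf { r | ∃ (U : Type) (_ : Fintype U) (pu : Xr × Xh → U → ℝ) (g : U → Xhat),
        IsKernel pu ∧
        expect (jointU0 p pu) (fun su => d su.1.1 (g su.2)) ≤ D ∧
        condH (jointU0 p pu) (fun su => su.1.2) (fun su => su.2) ≥ E ∧
        r = mutI (jointU0 p pu) (fun su => su.1) (fun su => su.2) }
    = sInf { r | ∃ q : Xr × Xh → Xhat → ℝ,
        IsKernel q ∧
        expect (jointU0 p q) (fun su => d su.1.1 su.2) ≤ D ∧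
        condH (jointU0 p q) (fun su => su.1.2) (fun su => su.2) ≥ E ∧
        r = mutI (jointU0 p q) (fun su => su.1) (fun su => su.2) } := by
  have hsub : ∀ r, (∃ q : Xr × Xh → Xhat → ℝ,
        IsKernel q ∧
        expect (jointU0 p q) (fun su => d su.1.1 su.2) ≤ D ∧
        condH (jointU0 p q) (fun su => su.1.2) (fun su => su.2) ≥ E ∧
        r = mutI (jointU0 p q) (fun su => su.1) (fun su => su.2)) →
      ∃ (U : Type) (_ : Fintype U) (pu : Xr × Xh → U → ℝ) (g : U → Xhat),
        IsKernel pu ∧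
        expect (jointU0 p pu) (fun su => d su.1.1 (g su.2)) ≤ D ∧
        condH (jointU0 p pu) (fun su => su.1.2) (fun su => su.2) ≥ E ∧
        r = mutI (jointU0 p pu) (fun su => su.1) (fun su => su.2) := by
    rintro r ⟨q, h⟩
    exact ⟨Xhat, inferInstance, q, id, h⟩
  have hle : ∀ r, (∃ (U : Type) (_ : Fintype U) (pu : Xr × Xh → U → ℝ) (g : U → Xhat),
        IsKernel pu ∧
        expect (jointU0 p pu) (fun su => d su.1.1 (g su.2)) ≤ D ∧
        condH (jointU0 p pu) (fun su => su.1.2) (fun su => su.2) ≥ E ∧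
        r = mutI (jointU0 p pu) (fun su => su.1) (fun su => su.2)) →
      ∃ r' ≤ r, ∃ q : Xr × Xh → Xhat → ℝ,
        IsKernel q ∧
        expect (jointU0 p q) (fun su => d su.1.1 su.2) ≤ D ∧
        condH (jointU0 p q) (fun su => su.1.2) (fun su => su.2) ≥ E ∧
        r' = mutI (jointU0 p q) (fun su => su.1) (fun su => su.2) := by
    rintro r ⟨U, _, pu, g, hpu, hdist, hequiv, rfl⟩
    have hμ := jointU0_nonneg hp.1 hpu
    refine ⟨_, ?_, fun s => pushf (pu s) g, isKernel_pushf hpu g, ?_, ?_, rfl⟩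
    · rw [jointU0_pushf]
      simp only [mutI, Hof_pushf]
      exact mutI_comp_le hμ (fun su => su.1) (fun su => su.2) g
    · rwa [jointU0_pushf, expect_pushf]
    · rw [jointU0_pushf]
      simp only [condH, Hof_pushf]
      exact hequiv.le.trans (condH_le_condH_comp hμ (fun su => su.1.2) (fun su => su.2) g)
  refine csInf_eq_csInf_of_forall_exists_le (fun r hr => ?_) fun r hr => ⟨r, hsub r hr, le_rfl⟩
  obtain ⟨r', hr', h⟩ := hle r hr
  exact ⟨r', h, hr'⟩
end
end
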